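/- Let v be a Barabanov norm for the linear switched system associated with M. For every v-extremal solution x associated with a switching signal A(·), with x(0) ≠ 0, there exists a nonzero solution l of the adjoint system associated with A(·), defined for all t ≥ 0, such that l(t) ∈ ∂v(x(t)) for every t ≥ 0 and, for almost every t ≥ 0, l(t)ᵀA(t)x(t) = 0 and l(t)ᵀB x(t) ≤ 0 for every B ∈ M. -/

import Mathlib

open MeasureTheory Filter Topology RealInnerProductSpace Matrix

noncomputable section

abbrev Vec (n : ℕ) := EuclideanSpace ℝ (Fin n)

def mulE {n : ℕ} (A : Matrix (Fin n) (Fin n) ℝ) (y : Vec n) : Vec n :=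
  Matrix.toEuclideanLin A y

def IsSolutionWith {n : ℕ} (M : Set (Matrix (Fin n) (Fin n) ℝ))
    (A : ℝ → Matrix (Fin n) (Fin n) ℝ) (x : ℝ → Vec n) : Prop :=
  (∀ i j, Measurable fun t => A t i j) ∧ (∀ t, A t ∈ M) ∧
    ContinuousOn x (Set.Ici 0) ∧
    ∀ t ≥ (0:ℝ), x t = x 0 + ∫ s in (0:ℝ)..t, mulE (A s) (x s)

def IsSolution {n : ℕ} (M : Set (Matrix (Fin n) (Fin n) ℝ)) (x : ℝ → Vec n) : Prop :=
  ∃ A, IsSolutionWith M A x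

def IsAdjointWith {n : ℕ} (A : ℝ → Matrix (Fin n) (Fin n) ℝ) (l : ℝ → Vec n) : Prop :=
  ContinuousOn l (Set.Ici 0) ∧
    ∀ t ≥ (0:ℝ), l t = l 0 - ∫ s in (0:ℝ)..t, mulE ((A s)ᵀ) (l s)

def IsNorm {n : ℕ} (v : Vec n → ℝ) : Prop :=
  (∀ x, v x = 0 ↔ x = 0) ∧ (∀ (a : ℝ) (x : Vec n), v (a • x) = |a| * v x) ∧
    ∀ x y, v (x + y) ≤ v x + v y

def IsBarabanov {n : ℕ} (M : Set (Matrix (Fin n) (Fin n) ℝ)) (v : Vec n → ℝ) : Prop :=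
  IsNorm v ∧ (∀ x, IsSolution M x → ∀ t ≥ (0:ℝ), v (x t) ≤ v (x 0)) ∧
    ∀ y : Vec n, ∃ x, IsSolution M x ∧ x 0 = y ∧ ∀ t ≥ (0:ℝ), v (x t) = v y

def IsExtremal {n : ℕ} (M : Set (Matrix (Fin n) (Fin n) ℝ)) (v : Vec n → ℝ)
    (x : ℝ → Vec n) : Prop :=
  IsSolution M x ∧ ∀ t ≥ (0:ℝ), v (x t) = v (x 0)

def subdiff {n : ℕ} (v : Vec n → ℝ) (x : Vec n) : Set (Vec n) :=
  {l | ⟪l, x⟫ = v x ∧ ∀ y, ⟪l, y⟫ ≤ v y}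

def MIrreducible {n : ℕ} (M : Set (Matrix (Fin n) (Fin n) ℝ)) : Prop :=
  ∀ W : Submodule ℝ (Vec n), (∀ A ∈ M, ∀ x ∈ W, mulE A x ∈ W) → W = ⊥ ∨ W = ⊤

def rhoZero {n : ℕ} (M : Set (Matrix (Fin n) (Fin n) ℝ)) : Prop :=
  sSup {r : EReal | ∃ x, IsSolution M x ∧ x 0 ≠ 0 ∧
      r = limsup (fun t => ((Real.log ‖x t‖ / t : ℝ) : EReal)) atTop} = 0

def MaxCondWith {n : ℕ} (M : Set (Matrix (Fin n) (Fin n) ℝ))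
    (A : ℝ → Matrix (Fin n) (Fin n) ℝ) (x l : ℝ → Vec n) : Prop :=
  ∀ᵐ t ∂(volume.restrict (Set.Ici (0:ℝ))),
    ∀ B ∈ M, ⟪l t, mulE B (x t)⟫ ≤ ⟪l t, mulE (A t) (x t)⟫

def ConditionG {n : ℕ} (M : Set (Matrix (Fin n) (Fin n) ℝ)) : Prop :=
  ∀ (x₀ l₀ : Vec n), x₀ ≠ 0 → l₀ ≠ 0 →
  ∀ A₁ A₂ (x₁ x₂ l₁ l₂ : ℝ → Vec n),
    IsSolutionWith M A₁ x₁ → IsSolutionWith M A₂ x₂ →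
    IsAdjointWith A₁ l₁ → IsAdjointWith A₂ l₂ →
    x₁ 0 = x₀ → x₂ 0 = x₀ → l₁ 0 = l₀ → l₂ 0 = l₀ →
    MaxCondWith M A₁ x₁ l₁ → MaxCondWith M A₂ x₂ l₂ →
    ∀ t ≥ (0:ℝ), x₁ t = x₂ t ∧ l₁ t = l₂ t

def omegaLimitSet {n : ℕ} (x : ℝ → Vec n) : Set (Vec n) :=
  {p | ∃ tk : ℕ → ℝ, Tendsto tk atTop atTop ∧ Tendsto (fun k => x (tk k)) atTop (𝓝 p)}

section LinearODE

variable {E F G : Type*} [NormedAddCommGroup E] [NormedSpace ℝ E] [CompleteSpace E]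
  [NormedAddCommGroup F] [NormedSpace ℝ F] [CompleteSpace F]
  [NormedAddCommGroup G] [NormedSpace ℝ G]

omit [CompleteSpace E] in
lemma intervalIntegrable_apply_of_bounded {L : ℝ → E →L[ℝ] E} {K : ℝ}
    (hL : StronglyMeasurable L) (hK : ∀ s, ‖L s‖ ≤ K) {u : ℝ → E} {a b : ℝ}
    (hu : ContinuousOn u (Set.uIcc a b)) :
    IntervalIntegrable (fun s => L s (u s)) volume a b := by
  obtain ⟨C, hC⟩ := isCompact_uIcc.exists_bound_of_continuousOn hu
  rw [intervalIntegrable_iff]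
  have : IsFiniteMeasure (volume.restrict (Set.uIoc a b)) := ⟨by simp [Set.uIoc]⟩
  refine Integrable.of_bound (C := K * C) ?_ ?_
  · exact (ContinuousLinearMap.id ℝ (E →L[ℝ] E)).aestronglyMeasurable_comp₂
      hL.aestronglyMeasurable
      ((hu.mono Set.uIoc_subset_uIcc).aestronglyMeasurable measurableSet_uIoc)
  · refine (ae_restrict_mem measurableSet_uIoc).mono fun s hs => ?_
    exact ((L s).le_opNorm _).trans (mul_le_mul (hK s) (hC s (Set.uIoc_subset_uIcc hs))
      (norm_nonneg _) ((norm_nonneg _).trans (hK s)))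

omit [CompleteSpace E] in
lemma norm_exp_smul_integral_le {L : ℝ → E →L[ℝ] E} {K : ℝ} (hK0 : 0 < K)
    (hK : ∀ s, ‖L s‖ ≤ K) {z : ℝ → E} {C : ℝ} (hz : ∀ s, ‖z s‖ ≤ C) {m : ℝ} (hm : 0 ≤ m) :
    ‖Real.exp (-(2 * K * m)) • ∫ s in (0:ℝ)..m, L s (Real.exp (2 * K * s) • z s)‖ ≤ C / 2 := by
  have hC : 0 ≤ C := (norm_nonneg _).trans (hz 0)
  have hI : ∫ s in (0:ℝ)..m, K * C * Real.exp (2 * K * s) =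
      C / 2 * (Real.exp (2 * K * m) - 1) := by
    rw [intervalIntegral.integral_const_mul,
      intervalIntegral.integral_comp_mul_left (fun s => Real.exp s) (by positivity)]
    simp only [integral_exp, smul_eq_mul, mul_zero, Real.exp_zero]
    field_simp
  have h1 : ‖∫ s in (0:ℝ)..m, L s (Real.exp (2 * K * s) • z s)‖ ≤
      C / 2 * (Real.exp (2 * K * m) - 1) := by
    rw [← hI]
    refine intervalIntegral.norm_integral_le_of_norm_le hm (ae_of_all _ fun s _ => ?_)
      (Continuous.intervalIntegrable (by fun_prop) _ _)
    have hs := (L s).le_of_opNorm_le_of_le (hK s)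
      (x := Real.exp (2 * K * s) • z s) (b := Real.exp (2 * K * s) * C) (by
        rw [norm_smul, Real.norm_of_nonneg (Real.exp_pos _).le]
        exact mul_le_mul_of_nonneg_left (hz s) (Real.exp_pos _).le)
    calc _ ≤ _ := hs
      _ = _ := by ring
  rw [norm_smul, Real.norm_of_nonneg (Real.exp_pos _).le]
  calc _ ≤ Real.exp (-(2 * K * m)) * (C / 2 * (Real.exp (2 * K * m) - 1)) :=
        mul_le_mul_of_nonneg_left h1 (Real.exp_pos _).le
    _ = C / 2 * (1 - Real.exp (-(2 * K * m))) := by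
        have : Real.exp (-(2 * K * m)) * Real.exp (2 * K * m) = 1 := by
          rw [← Real.exp_add]; simp
        linear_combination (C / 2) * this
    _ ≤ C / 2 := by nlinarith [Real.exp_pos (-(2 * K * m))]

/-- Carathéodory existence theorem for linear equations with bounded measurable coefficients. -/
theorem exists_solution_linear {L : ℝ → E →L[ℝ] E} {K : ℝ}
    (hL : StronglyMeasurable L) (hK0 : 0 < K) (hK : ∀ s, ‖L s‖ ≤ K) (u₀ : E) :
    ∃ u : ℝ → E, Continuous u ∧ u 0 = u₀ ∧
      ∀ t ≥ (0:ℝ), u t = u 0 + ∫ s in (0:ℝ)..t, L s (u s) := by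
  have hInt {z : ℝ → E} (hz : Continuous z) (a b : ℝ) :
      IntervalIntegrable (fun s => L s (Real.exp (2 * K * s) • z s)) volume a b :=
    intervalIntegrable_apply_of_bounded hL hK (by fun_prop)
  let f (z : ℝ → E) (t : ℝ) : E := Real.exp (-(2 * K * max t 0)) •
    (u₀ + ∫ s in (0:ℝ)..max t 0, L s (Real.exp (2 * K * s) • z s))
  have hf {z : ℝ → E} (hz : Continuous z) : Continuous (f z) := by
    have h1 : Continuous fun t => ∫ s in (0:ℝ)..t, L s (Real.exp (2 * K * s) • z s) :=
      intervalIntegral.continuous_primitive (fun a b => hInt hz a b) 0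
    have h2 : Continuous fun t : ℝ => max t 0 := by fun_prop
    have h3 := h1.comp h2
    have h4 : Continuous fun t : ℝ => Real.exp (-(2 * K * max t 0)) := by fun_prop
    exact h4.smul (continuous_const.add h3)
  have hfb (z : BoundedContinuousFunction ℝ E) (t : ℝ) : ‖f z t‖ ≤ ‖u₀‖ + ‖z‖ / 2 := by
    simp only [f, smul_add]
    refine (norm_add_le _ _).trans (add_le_add ?_ ?_)
    · rw [norm_smul, Real.norm_of_nonneg (Real.exp_pos _).le]
      exact mul_le_of_le_one_left (norm_nonneg _) (Real.exp_le_one_iff.2 (by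
        have := le_max_right t 0
        simp only [Left.neg_nonpos_iff]; positivity))
    · exact norm_exp_smul_integral_le hK0 hK z.norm_coe_le_norm (le_max_right _ _)
  let T (z : BoundedContinuousFunction ℝ E) : BoundedContinuousFunction ℝ E :=
    BoundedContinuousFunction.ofNormedAddCommGroup (f z) (hf z.continuous) _ (hfb z)
  have hT : ContractingWith (1 / 2) T := by
    refine ⟨by rw [div_lt_one] <;> norm_num, LipschitzWith.of_dist_le_mul fun z w => ?_⟩
    rw [BoundedContinuousFunction.dist_le (by positivity)]
    intro t
    have h : f z t - f w t = Real.exp (-(2 * K * max t 0)) •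
        ∫ s in (0:ℝ)..max t 0, L s (Real.exp (2 * K * s) • (z - w) s) := by
      simp only [f, ← smul_sub, add_sub_add_left_eq_sub]
      rw [← intervalIntegral.integral_sub (hInt z.continuous _ _) (hInt w.continuous _ _)]
      simp [smul_sub]
    change dist (f z t) (f w t) ≤ _
    rw [dist_eq_norm, h, dist_eq_norm]
    refine (norm_exp_smul_integral_le hK0 hK (z - w).norm_coe_le_norm
      (le_max_right _ _)).trans (le_of_eq ?_)
    push_cast
    ring
  have hz : T (hT.fixedPoint T) = hT.fixedPoint T := hT.fixedPoint_isFixedPt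
  set z := hT.fixedPoint T
  have hz' (t : ℝ) : f z t = z t := congrArg (fun g : BoundedContinuousFunction ℝ E => g t) hz
  have key : ∀ t ≥ (0:ℝ), Real.exp (2 * K * t) • z t =
      u₀ + ∫ s in (0:ℝ)..t, L s (Real.exp (2 * K * s) • z s) := by
    intro t ht
    rw [← hz' t]
    simp only [f, max_eq_left ht, smul_smul, ← Real.exp_add]
    simp
  have h0 : Real.exp (2 * K * 0) • z 0 = u₀ := by simpa using key 0 le_rfl
  refine ⟨fun t => Real.exp (2 * K * t) • z t, by fun_prop, h0, fun t ht => ?_⟩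
  simp only [h0]
  exact key t ht

omit [CompleteSpace E] in
lemma lipschitzOnWith_of_eq_integral {L : ℝ → E →L[ℝ] E} {K : ℝ}
    (hL : StronglyMeasurable L) (hK : ∀ s, ‖L s‖ ≤ K) {u : ℝ → E}
    (hu : ContinuousOn u (Set.Ici 0))
    (h : ∀ t ≥ (0:ℝ), u t = u 0 + ∫ s in (0:ℝ)..t, L s (u s)) (T : ℝ) :
    ∃ C, LipschitzOnWith C u (Set.Icc 0 T) := by
  obtain ⟨C, hC⟩ := isCompact_Icc.exists_bound_of_continuousOn
    (hu.mono Set.Icc_subset_Ici_self : ContinuousOn u (Set.Icc 0 T))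
  refine ⟨(K * C).toNNReal, LipschitzOnWith.of_dist_le' fun a ha b hb => ?_⟩
  have hi (a : ℝ) (ha : a ∈ Set.Icc 0 T) : IntervalIntegrable (fun s => L s (u s)) volume 0 a :=
    intervalIntegrable_apply_of_bounded hL hK
      (hu.mono (by rw [Set.uIcc_of_le ha.1]; exact Set.Icc_subset_Ici_self))
  rw [dist_eq_norm, h a ha.1, h b hb.1, add_sub_add_left_eq_sub,
    intervalIntegral.integral_interval_sub_left (hi a ha) (hi b hb), Real.dist_eq]
  refine intervalIntegral.norm_integral_le_of_norm_le_const fun s hs => ?_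
  have hs' : s ∈ Set.Icc 0 T := by
    have := Set.uIoc_subset_uIcc hs
    exact Set.uIcc_subset_Icc hb ha this
  exact (L s).le_of_opNorm_le_of_le (hK s) (hC s hs')

lemma ae_hasDerivAt_of_eq_integral {L : ℝ → E →L[ℝ] E} {K : ℝ}
    (hL : StronglyMeasurable L) (hK : ∀ s, ‖L s‖ ≤ K) {u : ℝ → E}
    (hu : ContinuousOn u (Set.Ici 0))
    (h : ∀ t ≥ (0:ℝ), u t = u 0 + ∫ s in (0:ℝ)..t, L s (u s)) :
    ∀ᵐ t, 0 < t → HasDerivAt u (L t (u t)) t := by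
  have hn : ∀ N : ℕ, ∀ᵐ t, t ∈ Set.uIcc (0:ℝ) N → ∀ c ∈ Set.uIcc (0:ℝ) N,
      HasDerivAt (fun r => ∫ s in c..r, L s (u s)) (L t (u t)) t := fun N =>
    IntervalIntegrable.ae_hasDerivAt_integral (intervalIntegrable_apply_of_bounded hL hK
      (hu.mono (by rw [Set.uIcc_of_le N.cast_nonneg]; exact Set.Icc_subset_Ici_self)))
  filter_upwards [ae_all_iff.2 hn] with t ht ht0
  obtain ⟨N, hN⟩ := exists_nat_ge t
  have h1 := ht N (by rw [Set.uIcc_of_le N.cast_nonneg]; exact ⟨ht0.le, hN⟩) 0 Set.left_mem_uIcc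
  refine (h1.const_add (u 0)).congr_of_eventuallyEq ?_
  filter_upwards [lt_mem_nhds ht0] with r hr using h r hr.le

/-- If the derivatives of two solutions cancel under a bilinear pairing, the pairing is constant. -/
theorem pairing_eq_of_eq_integral {L₁ : ℝ → E →L[ℝ] E} {L₂ : ℝ → F →L[ℝ] F} {K₁ K₂ : ℝ}
    (hL₁ : StronglyMeasurable L₁) (hK₁ : ∀ s, ‖L₁ s‖ ≤ K₁)
    (hL₂ : StronglyMeasurable L₂) (hK₂ : ∀ s, ‖L₂ s‖ ≤ K₂)
    (b : E →L[ℝ] F →L[ℝ] G) (hb : ∀ s e f, b e (L₂ s f) + b (L₁ s e) f = 0)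
    {p : ℝ → E} {w : ℝ → F} (hp : ContinuousOn p (Set.Ici 0)) (hw : ContinuousOn w (Set.Ici 0))
    (hpe : ∀ t ≥ (0:ℝ), p t = p 0 + ∫ s in (0:ℝ)..t, L₁ s (p s))
    (hwe : ∀ t ≥ (0:ℝ), w t = w 0 + ∫ s in (0:ℝ)..t, L₂ s (w s)) {t : ℝ} (ht : 0 ≤ t) :
    b (p t) (w t) = b (p 0) (w 0) := by
  obtain ⟨Cp, hCp⟩ := lipschitzOnWith_of_eq_integral hL₁ hK₁ hp hpe t
  obtain ⟨Cw, hCw⟩ := lipschitzOnWith_of_eq_integral hL₂ hK₂ hw hwe t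
  have hac : AbsolutelyContinuousOnInterval (fun s => b (p s) (w s)) 0 t := by
    obtain ⟨Bp, hBp⟩ := isCompact_Icc.exists_bound_of_continuousOn hCp.continuousOn
    obtain ⟨Bw, hBw⟩ := isCompact_Icc.exists_bound_of_continuousOn hCw.continuousOn
    have hlip : LipschitzOnWith (‖b‖ * (Bp * Cw + Cp * Bw)).toNNReal
        (fun s => b (p s) (w s)) (Set.uIcc 0 t) := by
      rw [Set.uIcc_of_le ht]
      refine LipschitzOnWith.of_dist_le' fun r hr s hs => ?_
      have e : b (p r) (w r) - b (p s) (w s) = b (p r) (w r - w s) + b (p r - p s) (w s) := by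
        simp
      have h1 := hCp.dist_le_mul r hr s hs
      have h2 := hCw.dist_le_mul r hr s hs
      rw [dist_eq_norm] at h1 h2
      rw [dist_eq_norm, e]
      calc _ ≤ ‖b‖ * ‖p r‖ * ‖w r - w s‖ + ‖b‖ * ‖p r - p s‖ * ‖w s‖ :=
            (norm_add_le _ _).trans (add_le_add (b.le_opNorm₂ _ _) (b.le_opNorm₂ _ _))
        _ ≤ ‖b‖ * Bp * (Cw * dist r s) + ‖b‖ * (Cp * dist r s) * Bw := by
            have := (norm_nonneg _).trans (hBp r hr)
            gcongr
            · exact hBp r hr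
            · exact hBw s hs
        _ = _ := by ring
    exact hlip.absolutelyContinuousOnInterval
  obtain ⟨C, hC⟩ := hac.const_of_ae_hasDerivAt_zero (by
    filter_upwards [ae_hasDerivAt_of_eq_integral hL₁ hK₁ hp hpe,
      ae_hasDerivAt_of_eq_integral hL₂ hK₂ hw hwe, Measure.ae_ne volume (0:ℝ)] with s h1 h2 h3 hs
    rw [Set.uIcc_of_le ht] at hs
    have hs0 : 0 < s := lt_of_le_of_ne hs.1 (Ne.symm h3)
    rw [← hb s (p s) (w s)]
    exact b.hasDerivAt_of_bilinear (fun _ => h1 hs0) (fun _ => h2 hs0))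
  rw [hC t Set.right_mem_uIcc, hC 0 Set.left_mem_uIcc]

end LinearODE

section SwitchedSystem

variable {n : ℕ} {M : Set (Matrix (Fin n) (Fin n) ℝ)} {A : ℝ → Matrix (Fin n) (Fin n) ℝ}

lemma continuous_toEuclideanCLM :
    Continuous fun B : Matrix (Fin n) (Fin n) ℝ => toEuclideanCLM (n := Fin n) (𝕜 := ℝ) B :=
  LinearMap.continuous_of_finiteDimensional
    (toEuclideanCLM (n := Fin n) (𝕜 := ℝ)).toAlgEquiv.toLinearMap

lemma stronglyMeasurable_toEuclideanCLM (hA : ∀ i j, Measurable fun t => A t i j) :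
    StronglyMeasurable fun t => toEuclideanCLM (n := Fin n) (𝕜 := ℝ) (A t) := by
  have h : Measurable fun t => (fun i j => A t i j : Fin n → Fin n → ℝ) :=
    measurable_pi_iff.2 fun i => measurable_pi_iff.2 fun j => hA i j
  exact Continuous.comp_stronglyMeasurable
    (g := fun B : Fin n → Fin n → ℝ => toEuclideanCLM (n := Fin n) (𝕜 := ℝ) (of B))
    continuous_toEuclideanCLM h.stronglyMeasurable

lemma exists_norm_toEuclideanCLM_le (hM : IsCompact M) :
    ∃ K : ℝ, 0 < K ∧ ∀ B ∈ M, ‖toEuclideanCLM (n := Fin n) (𝕜 := ℝ) B‖ ≤ K := by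
  obtain ⟨K, hK⟩ := hM.exists_bound_of_continuousOn continuous_toEuclideanCLM.continuousOn
  exact ⟨max K 1, by positivity, fun B hB => (hK B hB).trans (le_max_left _ _)⟩

lemma inner_mulE_transpose (B : Matrix (Fin n) (Fin n) ℝ) (y z : Vec n) :
    ⟪mulE Bᵀ y, z⟫ = ⟪y, mulE B z⟫ := by
  have h := toEuclideanLin_conjTranspose_eq_adjoint B
  rw [conjTranspose_eq_transpose_of_trivial] at h
  rw [mulE, h, LinearMap.adjoint_inner_left, mulE]

lemma IsNorm.nonneg {v : Vec n → ℝ} (hv : IsNorm v) (y : Vec n) : 0 ≤ v y := by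
  have h1 := hv.2.2 y (-y)
  have h2 := hv.2.1 (-1) y
  have h3 := (hv.1 0).2 rfl
  simp only [add_neg_cancel, neg_smul, one_smul, abs_neg, abs_one, one_mul] at h1 h2
  linarith

lemma exists_isSolutionWith_const {B : Matrix (Fin n) (Fin n) ℝ} (hB : B ∈ M) (y : Vec n) :
    ∃ u : ℝ → Vec n, Continuous u ∧ u 0 = y ∧ IsSolutionWith M (fun _ => B) u := by
  obtain ⟨u, hu, hu0, hue⟩ := exists_solution_linear
    (L := fun _ => toEuclideanCLM (n := Fin n) (𝕜 := ℝ) B)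
    (K := ‖toEuclideanCLM (n := Fin n) (𝕜 := ℝ) B‖ + 1) stronglyMeasurable_const
    (by positivity) (fun _ => by linarith) y
  exact ⟨u, hu, hu0, fun _ _ => measurable_const, fun _ => hB, hu.continuousOn, hue⟩

lemma IsSolutionWith.shift (hM : IsCompact M) {u : ℝ → Vec n} (hu : IsSolutionWith M A u)
    {t : ℝ} (ht : 0 ≤ t) : IsSolutionWith M (fun s => A (t + s)) (fun s => u (t + s)) := by
  obtain ⟨hA, hAM, huc, hue⟩ := hu
  obtain ⟨K, -, hK⟩ := exists_norm_toEuclideanCLM_le hM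
  refine ⟨fun i j => (hA i j).comp (measurable_const_add t), fun s => hAM _, ?_, fun s hs => ?_⟩
  · exact huc.comp (by fun_prop) fun s hs => add_nonneg ht hs
  have hInt (a : ℝ) (ha : 0 ≤ a) :
      IntervalIntegrable (fun s => mulE (A s) (u s)) volume 0 a :=
    intervalIntegrable_apply_of_bounded (stronglyMeasurable_toEuclideanCLM hA)
      (fun s => hK _ (hAM s)) (huc.mono (by
        rw [Set.uIcc_of_le ha]; exact Set.Icc_subset_Ici_self))
  have h := intervalIntegral.integral_comp_add_left (fun r => mulE (A r) (u r)) t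
    (a := 0) (b := s)
  change u (t + s) = u (t + 0) + ∫ r in (0:ℝ)..s, mulE (A (t + r)) (u (t + r))
  rw [h, add_zero, hue (t + s) (add_nonneg ht hs), hue t ht, add_assoc,
    intervalIntegral.integral_add_adjacent_intervals (hInt t ht)
      ((hInt t ht).symm.trans (hInt (t + s) (add_nonneg ht hs)))]

lemma IsBarabanov.apply_le (hM : IsCompact M) {v : Vec n → ℝ} (hv : IsBarabanov M v)
    {u : ℝ → Vec n} (hu : IsSolutionWith M A u) {s t : ℝ} (ht : 0 ≤ t) (hts : t ≤ s) :
    v (u s) ≤ v (u t) := by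
  have h := hv.2.1 _ ⟨_, hu.shift hM ht⟩ (s - t) (sub_nonneg.2 hts)
  simpa using h

/-- The transition operator of the linear system with signal `A`, started at time zero. -/
lemma exists_transition (hM : IsCompact M) (hA : ∀ i j, Measurable fun t => A t i j)
    (hAM : ∀ t, A t ∈ M) :
    ∃ Φ : ℝ → Vec n →L[ℝ] Vec n, Φ 0 = 1 ∧ (∀ z, IsSolutionWith M A fun t => Φ t z) ∧
      ∃ Ψ : ℝ → Vec n →L[ℝ] Vec n, ∀ t ≥ (0:ℝ), Φ t * Ψ t = 1 ∧
        ∀ u, IsSolutionWith M A u → Ψ t (u t) = u 0 := by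
  obtain ⟨K, hK0, hK⟩ := exists_norm_toEuclideanCLM_le hM
  let L (t : ℝ) : Vec n →L[ℝ] Vec n := toEuclideanCLM (n := Fin n) (𝕜 := ℝ) (A t)
  have hLm : StronglyMeasurable L := stronglyMeasurable_toEuclideanCLM hA
  have hLK (t : ℝ) : ‖L t‖ ≤ K := hK _ (hAM t)
  let mulL := ContinuousLinearMap.compL ℝ (Vec n) (Vec n) (Vec n)
  have hm₁ : StronglyMeasurable fun t => mulL (L t) :=
    mulL.continuous.comp_stronglyMeasurable hLm
  have hK₁ (t : ℝ) : ‖mulL (L t)‖ ≤ K :=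
    ContinuousLinearMap.opNorm_le_bound _ hK0.le fun X =>
      (norm_mul_le _ _).trans (mul_le_mul_of_nonneg_right (hLK t) (norm_nonneg _))
  have hm₂ : StronglyMeasurable fun t => -mulL.flip (L t) :=
    (mulL.flip.continuous.comp_stronglyMeasurable hLm).neg
  have hK₂ (t : ℝ) : ‖-mulL.flip (L t)‖ ≤ K := by
    rw [norm_neg]
    refine ContinuousLinearMap.opNorm_le_bound _ hK0.le fun X => ?_
    rw [mul_comm]
    exact (norm_mul_le _ _).trans (mul_le_mul_of_nonneg_left (hLK t) (norm_nonneg _))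
  obtain ⟨Φ, hΦ, hΦ0, hΦe⟩ := exists_solution_linear hm₁ hK0 hK₁ 1
  obtain ⟨Ψ, hΨ, hΨ0, hΨe⟩ := exists_solution_linear hm₂ hK0 hK₂ 1
  have hsol (z : Vec n) : IsSolutionWith M A fun t => Φ t z := by
    refine ⟨hA, hAM, by fun_prop, fun t ht => ?_⟩
    have hInt : IntervalIntegrable (fun s => mulL (L s) (Φ s)) volume 0 t :=
      intervalIntegrable_apply_of_bounded hm₁ hK₁ hΦ.continuousOn
    have h := ContinuousLinearMap.intervalIntegral_apply hInt z
    beta_reduce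
    nth_rw 1 [hΦe t ht]
    rw [_root_.add_apply, h]
    rfl
  have hpair (t : ℝ) (ht : 0 ≤ t) (u : ℝ → Vec n) (hu : IsSolutionWith M A u) :
      Ψ t (u t) = u 0 := by
    have h := pairing_eq_of_eq_integral hm₂ hK₂ hLm hLK
      (ContinuousLinearMap.id ℝ (Vec n →L[ℝ] Vec n)) (fun s X y => by simp [mulL])
      hΨ.continuousOn hu.2.2.1 hΨe hu.2.2.2 ht
    simpa [hΨ0] using h
  refine ⟨Φ, hΦ0, hsol, Ψ, fun t ht => ⟨?_, hpair t ht⟩⟩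
  have h : Ψ t * Φ t = 1 := by
    ext1 z
    simpa [hΦ0] using hpair t ht _ (hsol z)
  have h' : (Ψ t : Vec n →ₗ[ℝ] Vec n) * (Φ t : Vec n →ₗ[ℝ] Vec n) = 1 := by
    ext1 z
    exact DFunLike.congr_fun h z
  rw [mul_eq_one_comm] at h'
  ext1 z
  exact DFunLike.congr_fun h' z

lemma exists_isAdjointWith (hM : IsCompact M) (hA : ∀ i j, Measurable fun t => A t i j)
    (hAM : ∀ t, A t ∈ M) (l₀ : Vec n) :
    ∃ l, l 0 = l₀ ∧ IsAdjointWith A l ∧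
      ∀ u, IsSolutionWith M A u → ∀ t ≥ (0:ℝ), ⟪l t, u t⟫ = ⟪l₀, u 0⟫ := by
  obtain ⟨K, -, hK⟩ := exists_norm_toEuclideanCLM_le hM
  obtain ⟨K', hK'0, hK'⟩ := exists_norm_toEuclideanCLM_le
    (hM.image (continuous_id.matrix_transpose))
  have hm : StronglyMeasurable fun t => -toEuclideanCLM (n := Fin n) (𝕜 := ℝ) (A t)ᵀ :=
    (stronglyMeasurable_toEuclideanCLM (A := fun t => (A t)ᵀ) fun i j => hA j i).neg
  have hKm (t : ℝ) : ‖-toEuclideanCLM (n := Fin n) (𝕜 := ℝ) (A t)ᵀ‖ ≤ K' := by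
    rw [norm_neg]
    exact hK' _ ⟨A t, hAM t, rfl⟩
  obtain ⟨l, hl, hl0, hle⟩ := exists_solution_linear hm hK'0 hKm l₀
  refine ⟨l, hl0, ⟨hl.continuousOn, fun t ht => ?_⟩, fun u hu t ht => ?_⟩
  · rw [hle t ht, sub_eq_add_neg, ← intervalIntegral.integral_neg]
    rfl
  · rw [← hl0]
    exact pairing_eq_of_eq_integral hm hKm (stronglyMeasurable_toEuclideanCLM hA)
      (fun t => hK _ (hAM t)) (innerSL ℝ) (fun s y z => by
        change ⟪y, mulE (A s) z⟫ + ⟪-mulE (A s)ᵀ y, z⟫ = 0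
        rw [inner_neg_left, inner_mulE_transpose, add_neg_cancel])
      hl.continuousOn hu.2.2.1 hle hu.2.2.2 ht

/-- A supporting functional at the initial point which is dominated by the norm along the whole
flow. -/
lemma exists_dominated_functional {v : Vec n → ℝ} (hv : IsNorm v)
    {Φ : ℝ → Vec n →L[ℝ] Vec n} (hanti : ∀ z, AntitoneOn (fun t => v (Φ t z)) (Set.Ici 0))
    {x₀ : Vec n} (hx₀ : x₀ ≠ 0) (hconst : ∀ t ≥ (0:ℝ), v (Φ t x₀) = v x₀) :
    ∃ l₀ : Vec n, ⟪l₀, x₀⟫ = v x₀ ∧ ∀ t ≥ (0:ℝ), ∀ z, ⟪l₀, z⟫ ≤ v (Φ t z) := by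
  let q (z : Vec n) : ℝ := ⨅ k : ℕ, v (Φ k z)
  have hbdd (z : Vec n) : BddBelow (Set.range fun k : ℕ => v (Φ k z)) :=
    ⟨0, by rintro _ ⟨k, rfl⟩; exact hv.nonneg _⟩
  have hlim (z : Vec n) : Tendsto (fun k : ℕ => v (Φ k z)) atTop (𝓝 (q z)) :=
    tendsto_atTop_ciInf (fun k m hkm => hanti z (Set.mem_Ici.2 k.cast_nonneg)
      (Set.mem_Ici.2 m.cast_nonneg) (Nat.cast_le.2 hkm)) (hbdd z)
  have hqsmul (c : ℝ) (z : Vec n) : q (c • z) = |c| * q z := by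
    refine tendsto_nhds_unique (hlim (c • z)) (((hlim z).const_mul |c|).congr fun k => ?_)
    rw [map_smul, hv.2.1]
  have hqadd (y z : Vec n) : q (y + z) ≤ q y + q z :=
    le_of_tendsto_of_tendsto' (hlim _) ((hlim y).add (hlim z)) fun k => by
      rw [map_add]; exact hv.2.2 _ _
  have hqx : q x₀ = v x₀ :=
    tendsto_nhds_unique (hlim x₀) (tendsto_const_nhds.congr fun k =>
      (hconst k k.cast_nonneg).symm)
  obtain ⟨g, hg, hgq⟩ := exists_extension_of_le_sublinear
    (LinearPMap.mkSpanSingleton x₀ (v x₀) hx₀) q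
    (fun c hc z => by rw [hqsmul, abs_of_pos hc]) hqadd (by
      rintro ⟨z, hz⟩
      obtain ⟨c, rfl⟩ := Submodule.mem_span_singleton.1 hz
      rw [LinearPMap.mkSpanSingleton'_apply, hqsmul, hqx, smul_eq_mul]
      exact mul_le_mul_of_nonneg_right (le_abs_self c) (hv.nonneg _))
  have hl₀ (z : Vec n) : ⟪(InnerProductSpace.toDual ℝ (Vec n)).symm
      (LinearMap.toContinuousLinearMap g), z⟫ = g z := by
    rw [InnerProductSpace.toDual_symm_apply]; rfl
  refine ⟨_, (hl₀ x₀).trans ?_, fun t ht z => (hl₀ z).trans_le ((hgq z).trans ?_)⟩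
  · have h := hg ⟨x₀, Submodule.mem_span_singleton_self x₀⟩
    rw [LinearPMap.mkSpanSingleton_apply] at h
    exact h
  · obtain ⟨k, hk⟩ := exists_nat_ge t
    exact (ciInf_le (hbdd z) k).trans (hanti z ht (Set.mem_Ici.2 k.cast_nonneg) hk)

lemma IsBarabanov.inner_mulE_nonpos {v : Vec n → ℝ} (hv : IsBarabanov M v) {y l : Vec n}
    (hl : l ∈ subdiff v y) {B : Matrix (Fin n) (Fin n) ℝ} (hB : B ∈ M) :
    ⟪l, mulE B y⟫ ≤ 0 := by
  obtain ⟨u, hu, hu0, hsol⟩ := exists_isSolutionWith_const hB y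
  have hcont : Continuous fun s => mulE B (u s) :=
    (toEuclideanCLM (n := Fin n) (𝕜 := ℝ) B).continuous.comp hu
  have hd : HasDerivAt (fun t => ∫ s in (0:ℝ)..t, mulE B (u s)) (mulE B (u 0)) 0 :=
    intervalIntegral.integral_hasDerivAt_right (by simp)
      (hcont.stronglyMeasurableAtFilter _ _) hcont.continuousAt
  have hd' := (innerSL ℝ l).hasFDerivAt.comp_hasDerivAt (0:ℝ) hd
  have hs := hd'.hasDerivWithinAt (s := Set.Ioi 0)
  rw [hasDerivWithinAt_iff_tendsto_slope' (by simp)] at hs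
  rw [hu0] at hs
  refine le_of_tendsto hs (eventually_nhdsWithin_of_forall fun t ht => ?_)
  have ht0 : (0:ℝ) < t := ht
  have h1 := (hl.2 (u t)).trans (hv.2.1 u ⟨_, hsol⟩ t ht0.le)
  rw [hsol.2.2.2 t ht0.le, hu0, inner_add_right, hl.1] at h1
  simp only [slope_def_field, Function.comp_apply, innerSL_apply_apply,
    intervalIntegral.integral_same, inner_zero_right, sub_zero]
  exact div_nonpos_of_nonpos_of_nonneg (by linarith) ht0.le

end SwitchedSystem

theorem stmt2 (n : ℕ) (hn : 0 < n) (M : Set (Matrix (Fin n) (Fin n) ℝ))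
    (hne : M.Nonempty) (hcpt : IsCompact M) (hconv : Convex ℝ M)
    (v : Vec n → ℝ) (hv : IsBarabanov M v)
    (A : ℝ → Matrix (Fin n) (Fin n) ℝ) (x : ℝ → Vec n)
    (hx : IsSolutionWith M A x) (hxe : ∀ t ≥ (0:ℝ), v (x t) = v (x 0))
    (hx0 : x 0 ≠ 0) :
    ∃ l : ℝ → Vec n, l 0 ≠ 0 ∧ IsAdjointWith A l ∧
      (∀ t ≥ (0:ℝ), l t ∈ subdiff v (x t)) ∧
      ∀ᵐ t ∂(volume.restrict (Set.Ici (0:ℝ))),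
        ⟪l t, mulE (A t) (x t)⟫ = 0 ∧ ∀ B ∈ M, ⟪l t, mulE B (x t)⟫ ≤ 0 := by
  obtain ⟨hA, hAM, hxc, hxi⟩ := id hx
  obtain ⟨Φ, hΦ0, hΦ, Ψ, hΨ⟩ := exists_transition hcpt hA hAM
  have hinv {t : ℝ} (ht : 0 ≤ t) (y : Vec n) : Φ t (Ψ t y) = y :=
    DFunLike.congr_fun (hΨ t ht).1 y
  obtain ⟨l₀, hl₀x, hl₀⟩ := exists_dominated_functional hv.1 (Φ := Φ)
    (fun z s hs t _ hst => hv.apply_le hcpt (hΦ z) hs hst) hx0 (fun t ht => by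
      rw [← (hΨ t ht).2 x hx, hinv ht, (hΨ t ht).2 x hx, hxe t ht])
  obtain ⟨l, hl0, hadj, hl⟩ := exists_isAdjointWith hcpt hA hAM l₀
  have hsub : ∀ t ≥ (0:ℝ), l t ∈ subdiff v (x t) := by
    intro t ht
    refine ⟨by rw [hl x hx t ht, hl₀x, hxe t ht], fun y => ?_⟩
    have h1 := hl _ (hΦ (Ψ t y)) t ht
    have h2 := hl₀ t ht (Ψ t y)
    rw [hinv ht] at h1 h2
    rw [h1, hΦ0]
    exact h2
  refine ⟨l, ?_, hadj, hsub, ?_⟩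
  · intro h
    rw [← hl0, h, inner_zero_left] at hl₀x
    exact hx0 ((hv.1.1 _).1 hl₀x.symm)
  obtain ⟨K, -, hK⟩ := exists_norm_toEuclideanCLM_le hcpt
  have hder := ae_hasDerivAt_of_eq_integral (stronglyMeasurable_toEuclideanCLM hA)
    (fun t => hK _ (hAM t)) hxc hxi
  rw [ae_restrict_iff' measurableSet_Ici]
  filter_upwards [hder, Measure.ae_ne volume (0:ℝ)] with t ht htne ht0
  have htpos : 0 < t := lt_of_le_of_ne ht0 htne.symm
  refine ⟨?_, fun B hB => hv.inner_mulE_nonpos (hsub t ht0) hB⟩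
  have hd := (innerSL ℝ (l t)).hasFDerivAt.comp_hasDerivAt t (ht htpos)
  refine IsLocalMax.hasDerivAt_eq_zero ?_ hd
  filter_upwards [lt_mem_nhds htpos] with s hs
  simp only [Function.comp_apply, innerSL_apply_apply]
  rw [(hsub t ht0).1, hxe t ht0, ← hxe s hs.le]
  exact (hsub t ht0).2 _
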